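/- arXiv:1103.4964 — 2 statements merged into one kernel-verified Lean document; each statement's English description precedes it below -/
import Mathlib

section
/- The second and third pages of the basic spectral sequence are: E_2^{i,0} = E_3^{i,0} ≅ H^i(Ω), and for every j > 0, E_2^{i,2j} = E_3^{i,2j} ≅ H^i(𝒦) ⊗ ℝ·u^j, where 𝒦 = Ω/G is the co-Gysin complex. -/
/-!
Common algebraic model for the paper "Intersection cohomology of circle actions"
(Padilla–Saralegi), following the CONTEXT of the statements.

`A` models the (total space of the) graded-commutative differential graded ℝ-algebra
`A = ⊕ₙ Aⁿ` of liftable forms on the orbit space `B`; the grading is only recorded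
through the families of graded subspaces `P Q : ℤ → Submodule ℝ A` (the forms of
perverse degree `≤ p̄` resp. `≤ p̄ - x̄`), which vanish in negative degrees
(`Aⁿ = 0` for `n < 0`).  The differential is `d` with `d ∘ d = 0`, and
`e : A →ₗ[ℝ] A` is right multiplication by the fixed Euler form `ε ∈ A²`;
the hypotheses `dε = 0` together with the graded Leibniz rule amount exactly to
the commutation `d ∘ e = e ∘ d`, which is how we encode them.
-/

open Submodule LinearMap

noncomputable section

namespace IG

variable {A : Type*} [AddCommGroup A] [Module ℝ A]

/-- `Ω^n = {α ∈ P^n : dα ∈ P^(n+1)}`. -/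
def Om (d : A →ₗ[ℝ] A) (P : ℤ → Submodule ℝ A) (n : ℤ) : Submodule ℝ A :=
  P n ⊓ (P (n + 1)).comap d

/-- First component of `D` in degree `n` : `(α, β) ↦ dα + (-1)^(n-1) β∧ε`. -/
def D1 (d e : A →ₗ[ℝ] A) (n : ℤ) : A × A →ₗ[ℝ] A :=
  d ∘ₗ LinearMap.fst ℝ A A + ((-1 : ℝ) ^ (n - 1)) • (e ∘ₗ LinearMap.snd ℝ A A)

/-- `D(α,β) = (dα + (-1)^(n-1) β∧ε, dβ)` in degree `n`. -/
def Dmap (d e : A →ₗ[ℝ] A) (n : ℤ) : A × A →ₗ[ℝ] A × A :=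
  (D1 d e n).prod (d ∘ₗ LinearMap.snd ℝ A A)

/-- `K^n = {(α,β) ∈ P^n × Q^(n-1) : dβ ∈ Q^n, dα + (-1)^(n-1) β∧ε ∈ P^(n+1)}`. -/
def Ksub (d e : A →ₗ[ℝ] A) (P Q : ℤ → Submodule ℝ A) (n : ℤ) : Submodule ℝ (A × A) :=
  (P n).comap (LinearMap.fst ℝ A A) ⊓ (Q (n - 1)).comap (LinearMap.snd ℝ A A) ⊓
    (Q n).comap (d ∘ₗ LinearMap.snd ℝ A A) ⊓ (P (n + 1)).comap (D1 d e n)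

/-- `G^n = {β ∈ Q^n : dβ ∈ Q^(n+1), ∃ α ∈ P^(n+1), dα + (-1)^n β∧ε ∈ P^(n+2)}`. -/
def Gsub (d e : A →ₗ[ℝ] A) (P Q : ℤ → Submodule ℝ A) (n : ℤ) : Submodule ℝ A :=
  Q n ⊓ (Q (n + 1)).comap d ⊓
    (((P (n + 1)).comap (LinearMap.fst ℝ A A) ⊓
        (P (n + 2)).comap
          (d ∘ₗ LinearMap.fst ℝ A A + ((-1 : ℝ) ^ n) • (e ∘ₗ LinearMap.snd ℝ A A))).map
      (LinearMap.snd ℝ A A))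

/-- `C^m = ⊕_{i+2j=m} K^i ⊗ ℝ·u^j`, realized as the functions `ω : ℕ → A × A`
(`ω j` = the coefficient of `u^j`) with `ω j ∈ K^(m-2j)` for all `j`. -/
def Csub (d e : A →ₗ[ℝ] A) (P Q : ℤ → Submodule ℝ A) (m : ℤ) : Submodule ℝ (ℕ → A × A) :=
  ⨅ j : ℕ, (Ksub d e P Q (m - 2 * (j : ℤ))).comap (LinearMap.proj (R := ℝ) j)

/-- `∇((α,β) ⊗ u^j) = D(α,β) ⊗ u^j + (-1)^(n-1) (β,0) ⊗ u^(j+1)` on total degree `m`. -/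
def nabla (d e : A →ₗ[ℝ] A) (m : ℤ) : (ℕ → A × A) →ₗ[ℝ] (ℕ → A × A) :=
  LinearMap.pi fun j : ℕ =>
    Dmap d e (m - 2 * (j : ℤ)) ∘ₗ LinearMap.proj j +
      if j = 0 then 0
      else ((-1 : ℝ) ^ (m - 2 * ((j : ℤ) - 1) - 1)) •
        (LinearMap.inl ℝ A A ∘ₗ LinearMap.snd ℝ A A ∘ₗ LinearMap.proj (j - 1))

/-- Multiplication by `u` (degree 2) on an `ℝ[u]`-module realized as `ℕ → M`. -/
def shiftL (M : Type*) [AddCommGroup M] [Module ℝ M] : (ℕ → M) →ₗ[ℝ] (ℕ → M) :=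
  LinearMap.pi fun j : ℕ => if j = 0 then 0 else LinearMap.proj (j - 1)

/-- `π' (α ⊗ u^j) = (α, 0) ⊗ u^j`. -/
def piMap : (ℕ → A) →ₗ[ℝ] ℕ → A × A :=
  LinearMap.pi fun j : ℕ => LinearMap.inl ℝ A A ∘ₗ LinearMap.proj j

/-- `∮' ((α,β) ⊗ u^j) = β ⊗ u^j`. -/
def ointMap : (ℕ → A × A) →ₗ[ℝ] ℕ → A :=
  LinearMap.pi fun j : ℕ => LinearMap.snd ℝ A A ∘ₗ LinearMap.proj j

/-- `d ⊗ 1`. -/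
def dpi (d : A →ₗ[ℝ] A) : (ℕ → A) →ₗ[ℝ] ℕ → A :=
  LinearMap.pi fun j : ℕ => d ∘ₗ LinearMap.proj j

/-- `(Ω ⊗ ℝ[u])^m`. -/
def OmC (d : A →ₗ[ℝ] A) (P : ℤ → Submodule ℝ A) (m : ℤ) : Submodule ℝ (ℕ → A) :=
  ⨅ j : ℕ, (Om d P (m - 2 * (j : ℤ))).comap (LinearMap.proj (R := ℝ) j)

/-- `(G[-1] ⊗ ℝ[u])^m` (`G[-1]` places `G^n` in degree `n+1`). -/
def GCs (d e : A →ₗ[ℝ] A) (P Q : ℤ → Submodule ℝ A) (m : ℤ) : Submodule ℝ (ℕ → A) :=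
  ⨅ j : ℕ, (Gsub d e P Q (m - 1 - 2 * (j : ℤ))).comap (LinearMap.proj (R := ℝ) j)

/-- Cohomology presented as (cocycles) / (coboundaries). -/
abbrev Hq {M : Type*} [AddCommGroup M] [Module ℝ M] (Z B : Submodule ℝ M) :=
  Z ⧸ (B.comap Z.subtype)

/-- Cocycles of `Ω`. -/
def ZOm (d : A →ₗ[ℝ] A) (P : ℤ → Submodule ℝ A) (n : ℤ) : Submodule ℝ A :=
  Om d P n ⊓ LinearMap.ker d

/-- Coboundaries of `Ω`. -/
def BOm (d : A →ₗ[ℝ] A) (P : ℤ → Submodule ℝ A) (n : ℤ) : Submodule ℝ A :=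
  (Om d P (n - 1)).map d

/-- `H^n(Ω)`. -/
abbrev HOm (d : A →ₗ[ℝ] A) (P : ℤ → Submodule ℝ A) (n : ℤ) :=
  Hq (ZOm d P n) (BOm d P n)

/-- Cocycles of `G`. -/
def ZG (d e : A →ₗ[ℝ] A) (P Q : ℤ → Submodule ℝ A) (n : ℤ) : Submodule ℝ A :=
  Gsub d e P Q n ⊓ LinearMap.ker d

/-- Coboundaries of `G`. -/
def BG (d e : A →ₗ[ℝ] A) (P Q : ℤ → Submodule ℝ A) (n : ℤ) : Submodule ℝ A :=
  (Gsub d e P Q (n - 1)).map d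

/-- `H^n(G)`. -/
abbrev HG (d e : A →ₗ[ℝ] A) (P Q : ℤ → Submodule ℝ A) (n : ℤ) :=
  Hq (ZG d e P Q n) (BG d e P Q n)

/-- The co-Gysin space `𝒦^n = Ω^n / G^n` (cochain level). -/
abbrev Kq (d e : A →ₗ[ℝ] A) (P Q : ℤ → Submodule ℝ A) (n : ℤ) :=
  (Om d P n) ⧸ ((Gsub d e P Q n).comap (Om d P n).subtype)

/-- Cocycles of the co-Gysin complex `𝒦 = Ω/G`, presented by representatives:
`α ∈ Ω^n` with `dα ∈ G^(n+1)`. -/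
def ZKo (d e : A →ₗ[ℝ] A) (P Q : ℤ → Submodule ℝ A) (n : ℤ) : Submodule ℝ A :=
  Om d P n ⊓ (Gsub d e P Q (n + 1)).comap d

/-- Representatives of coboundaries of `𝒦 = Ω/G`. -/
def BKo (d e : A →ₗ[ℝ] A) (P Q : ℤ → Submodule ℝ A) (n : ℤ) : Submodule ℝ A :=
  Gsub d e P Q n ⊔ (Om d P (n - 1)).map d

/-- `H^n(𝒦)`. -/
abbrev HKo (d e : A →ₗ[ℝ] A) (P Q : ℤ → Submodule ℝ A) (n : ℤ) :=
  Hq (ZKo d e P Q n) (BKo d e P Q n)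

/-- Cocycles of `(C, ∇)`. -/
def ZC (d e : A →ₗ[ℝ] A) (P Q : ℤ → Submodule ℝ A) (m : ℤ) : Submodule ℝ (ℕ → A × A) :=
  Csub d e P Q m ⊓ LinearMap.ker (nabla d e m)

/-- Coboundaries of `(C, ∇)`. -/
def BC (d e : A →ₗ[ℝ] A) (P Q : ℤ → Submodule ℝ A) (m : ℤ) : Submodule ℝ (ℕ → A × A) :=
  (Csub d e P Q (m - 1)).map (nabla d e (m - 1))

/-- `H^m(C)`, the equivariant intersection cohomology. -/
abbrev HC (d e : A →ₗ[ℝ] A) (P Q : ℤ → Submodule ℝ A) (m : ℤ) :=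
  Hq (ZC d e P Q m) (BC d e P Q m)

/-- Cocycles of `(Ω ⊗ ℝ[u], d ⊗ 1)`. -/
def ZOmC (d : A →ₗ[ℝ] A) (P : ℤ → Submodule ℝ A) (m : ℤ) : Submodule ℝ (ℕ → A) :=
  OmC d P m ⊓ LinearMap.ker (dpi d)

/-- Coboundaries of `(Ω ⊗ ℝ[u], d ⊗ 1)`. -/
def BOmC (d : A →ₗ[ℝ] A) (P : ℤ → Submodule ℝ A) (m : ℤ) : Submodule ℝ (ℕ → A) :=
  (OmC d P (m - 1)).map (dpi d)

/-- `[H(Ω) ⊗ ℝ[u]]^m`, as the cohomology of the complex `(Ω ⊗ ℝ[u], d ⊗ 1)`. -/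
abbrev HOmCq (d : A →ₗ[ℝ] A) (P : ℤ → Submodule ℝ A) (m : ℤ) :=
  Hq (ZOmC d P m) (BOmC d P m)

/-- Cocycles of `(G[-1] ⊗ ℝ[u], d ⊗ 1)`. -/
def ZGC (d e : A →ₗ[ℝ] A) (P Q : ℤ → Submodule ℝ A) (m : ℤ) : Submodule ℝ (ℕ → A) :=
  GCs d e P Q m ⊓ LinearMap.ker (dpi d)

/-- Coboundaries of `(G[-1] ⊗ ℝ[u], d ⊗ 1)`. -/
def BGC (d e : A →ₗ[ℝ] A) (P Q : ℤ → Submodule ℝ A) (m : ℤ) : Submodule ℝ (ℕ → A) :=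
  (GCs d e P Q (m - 1)).map (dpi d)

/-- `[H(G) ⊗ ℝ[u]]^(m-1)`, as the cohomology of `(G[-1] ⊗ ℝ[u], d ⊗ 1)` in degree `m`. -/
abbrev HGCq (d e : A →ₗ[ℝ] A) (P Q : ℤ → Submodule ℝ A) (m : ℤ) :=
  Hq (ZGC d e P Q m) (BGC d e P Q m)

/-- The subspace of `ω : ℕ → A × A` supported in (filtration) degrees `≥ i`
(for total degree `m`): `ω j = 0` whenever `m - 2j < i`. -/
def Supp (i m : ℤ) : Submodule ℝ (ℕ → A × A) :=
  ⨅ (j : ℕ) (_ : m - 2 * (j : ℤ) < i),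
    LinearMap.ker (LinearMap.proj (R := ℝ) (φ := fun _ : ℕ => A × A) j)

/-- The filtration `F^i C^m = {ω ∈ ⊕_{i'≥i} K^{i'} ⊗ ℝ[u] of total degree m :
∇ω ∈ ⊕_{i'≥i} K^{i'} ⊗ ℝ[u]}`. -/
def FC (d e : A →ₗ[ℝ] A) (P Q : ℤ → Submodule ℝ A) (i m : ℤ) : Submodule ℝ (ℕ → A × A) :=
  Csub d e P Q m ⊓ Supp i m ⊓ (Supp i (m + 1)).comap (nabla d e m)

/-- `Z_r^{i,j} = F^i C^(i+j) ∩ ∇⁻¹(F^(i+r) C^(i+j+1))`. -/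
def Zsp (d e : A →ₗ[ℝ] A) (P Q : ℤ → Submodule ℝ A) (r i j : ℤ) : Submodule ℝ (ℕ → A × A) :=
  FC d e P Q i (i + j) ⊓ (FC d e P Q (i + r) (i + j + 1)).comap (nabla d e (i + j))

/-- `B_r^{i,j} = F^i C^(i+j) ∩ ∇(F^(i-r) C^(i+j-1))`. -/
def Bsp (d e : A →ₗ[ℝ] A) (P Q : ℤ → Submodule ℝ A) (r i j : ℤ) : Submodule ℝ (ℕ → A × A) :=
  FC d e P Q i (i + j) ⊓ (FC d e P Q (i - r) (i + j - 1)).map (nabla d e (i + j - 1))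

/-- `E_r^{i,j} = Z_r^{i,j} / (Z_(r-1)^{i+1,j-1} + B_(r-1)^{i,j})`. -/
abbrev Esp (d e : A →ₗ[ℝ] A) (P Q : ℤ → Submodule ℝ A) (r i j : ℤ) :=
  Zsp d e P Q r i j ⧸
    ((Zsp d e P Q (r - 1) (i + 1) (j - 1) ⊔ Bsp d e P Q (r - 1) i j).comap
      (Zsp d e P Q r i j).subtype)

/-- The differential `d_r : E_r^{i,j} → E_r^{i+r,j-r+1}` is the map induced by `∇`
(the target indices `(i', j')` are given freely, to be instantiated by
expressions equal to `(i + r, j - r + 1)`). -/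
def DrChar (d e : A →ₗ[ℝ] A) (P Q : ℤ → Submodule ℝ A) (r i j i' j' : ℤ)
    (dr : Esp d e P Q r i j →ₗ[ℝ] Esp d e P Q r i' j') : Prop :=
  ∀ (ω : ℕ → A × A) (hω : ω ∈ Zsp d e P Q r i j)
    (hω' : nabla d e (i + j) ω ∈ Zsp d e P Q r i' j'),
    dr (Submodule.Quotient.mk ⟨ω, hω⟩) = Submodule.Quotient.mk ⟨nabla d e (i + j) ω, hω'⟩

/-- `α ↦ (α, 0) ⊗ u^0 = (α,0) ⊗ 1`. -/
def embL : A →ₗ[ℝ] ℕ → A × A :=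
  LinearMap.single ℝ (fun _ : ℕ => A × A) 0 ∘ₗ LinearMap.inl ℝ A A

/-- `ι̃ : H^n(G) → H^{n'}(Ω)` induced by the inclusion `G ⊆ Ω` (`n' = n`). -/
def iotaChar (d e : A →ₗ[ℝ] A) (P Q : ℤ → Submodule ℝ A) (n n' : ℤ)
    (ι : HG d e P Q n →ₗ[ℝ] HOm d P n') : Prop :=
  ∀ (β : A) (hβ : β ∈ ZG d e P Q n) (hβ' : β ∈ ZOm d P n'),
    ι (Submodule.Quotient.mk ⟨β, hβ⟩) = Submodule.Quotient.mk ⟨β, hβ'⟩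

/-- `𝕖 : H^n(G) → H^{n'}(Ω)`, `𝕖[β] = [dα + (-1)^n β∧ε]` for any witness `α`
(`n' = n + 2`). -/
def eulerChar (d e : A →ₗ[ℝ] A) (P Q : ℤ → Submodule ℝ A) (n n' : ℤ)
    (E : HG d e P Q n →ₗ[ℝ] HOm d P n') : Prop :=
  ∀ (β : A) (hβ : β ∈ ZG d e P Q n) (α : A) (_ : α ∈ P (n + 1))
    (hz : d α + ((-1 : ℝ) ^ n) • e β ∈ ZOm d P n'),
    E (Submodule.Quotient.mk ⟨β, hβ⟩) =
      Submodule.Quotient.mk ⟨d α + ((-1 : ℝ) ^ n) • e β, hz⟩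

/-- `∂ : H^n(𝒦) → H^{n'}(G)`, `∂[ᾱ] = [dα]` (`n' = n + 1`). -/
def partialChar (d e : A →ₗ[ℝ] A) (P Q : ℤ → Submodule ℝ A) (n n' : ℤ)
    (pd : HKo d e P Q n →ₗ[ℝ] HG d e P Q n') : Prop :=
  ∀ (α : A) (hα : α ∈ ZKo d e P Q n) (hd : d α ∈ ZG d e P Q n'),
    pd (Submodule.Quotient.mk ⟨α, hα⟩) = Submodule.Quotient.mk ⟨d α, hd⟩

/-- `Pr : H^n(Ω) → H^{n'}(𝒦)` induced by the projection `Ω → 𝒦 = Ω/G` (`n' = n`). -/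
def prChar (d e : A →ₗ[ℝ] A) (P Q : ℤ → Submodule ℝ A) (n n' : ℤ)
    (pr : HOm d P n →ₗ[ℝ] HKo d e P Q n') : Prop :=
  ∀ (α : A) (hα : α ∈ ZOm d P n) (hα' : α ∈ ZKo d e P Q n'),
    pr (Submodule.Quotient.mk ⟨α, hα⟩) = Submodule.Quotient.mk ⟨α, hα'⟩

theorem mem_Om {d : A →ₗ[ℝ] A} {P : ℤ → Submodule ℝ A} {n : ℤ} {α : A} :
    α ∈ Om d P n ↔ α ∈ P n ∧ d α ∈ P (n + 1) := by
  simp [Om]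

theorem mem_Ksub {d e : A →ₗ[ℝ] A} {P Q : ℤ → Submodule ℝ A} {n : ℤ} {x : A × A} :
    x ∈ Ksub d e P Q n ↔ x.1 ∈ P n ∧ x.2 ∈ Q (n - 1) ∧ d x.2 ∈ Q n ∧
      d x.1 + ((-1 : ℝ) ^ (n - 1)) • e x.2 ∈ P (n + 1) := by
  simp [Ksub, D1, and_assoc]

theorem mem_Gsub {d e : A →ₗ[ℝ] A} {P Q : ℤ → Submodule ℝ A} {n : ℤ} {β : A} :
    β ∈ Gsub d e P Q n ↔ ∃ α, (α, β) ∈ Ksub d e P Q (n + 1) := by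
  have h : n + 1 + 1 = n + 2 := by ring
  simp only [Gsub, mem_Ksub, h, add_sub_cancel_right, mem_inf, mem_comap, mem_map,
    LinearMap.add_apply, LinearMap.smul_apply, LinearMap.comp_apply, fst_apply, snd_apply,
    Prod.exists]
  constructor
  · rintro ⟨⟨h1, h2⟩, α, β, ⟨h3, h4⟩, rfl⟩
    exact ⟨α, h3, h1, h2, h4⟩
  · rintro ⟨α, h3, h1, h2, h4⟩
    exact ⟨⟨h1, h2⟩, α, β, ⟨h3, h4⟩, rfl⟩

theorem mk_zero_mem_Ksub {d e : A →ₗ[ℝ] A} {P Q : ℤ → Submodule ℝ A} {n : ℤ} {α : A} :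
    (α, 0) ∈ Ksub d e P Q n ↔ α ∈ Om d P n := by
  simp [mem_Ksub, mem_Om]

theorem fst_mem_Om {d e : A →ₗ[ℝ] A} {P Q : ℤ → Submodule ℝ A} {n : ℤ} {x : A × A}
    (hx : x ∈ Ksub d e P Q n) (h : x.2 = 0) : x.1 ∈ Om d P n := by
  rw [← mk_zero_mem_Ksub (e := e) (Q := Q), ← h]
  exact hx

theorem mem_Csub {d e : A →ₗ[ℝ] A} {P Q : ℤ → Submodule ℝ A} {m : ℤ} {ω : ℕ → A × A} :
    ω ∈ Csub d e P Q m ↔ ∀ k : ℕ, ω k ∈ Ksub d e P Q (m - 2 * (k : ℤ)) := by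
  simp [Csub]

theorem single_mem_Csub {d e : A →ₗ[ℝ] A} {P Q : ℤ → Submodule ℝ A} {m : ℤ} {j : ℕ}
    {x : A × A} (hx : x ∈ Ksub d e P Q (m - 2 * (j : ℤ))) :
    (Pi.single j x : ℕ → A × A) ∈ Csub d e P Q m := by
  rw [mem_Csub]
  intro k
  by_cases h : k = j
  · subst h
    simpa using hx
  · simp [Pi.single_eq_of_ne h]

theorem nabla_zero_fst (d e : A →ₗ[ℝ] A) (m : ℤ) (ω : ℕ → A × A) :
    (nabla d e m ω 0).1 = d (ω 0).1 + ((-1 : ℝ) ^ (m - 1)) • e (ω 0).2 := by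
  simp [nabla, Dmap, D1]

theorem nabla_succ_fst (d e : A →ₗ[ℝ] A) (m : ℤ) (ω : ℕ → A × A) (k : ℕ) :
    (nabla d e m ω (k + 1)).1 = d (ω (k + 1)).1 +
      ((-1 : ℝ) ^ (m - 1)) • (e (ω (k + 1)).2 + (ω k).2) := by
  have h1 : (-1 : ℝ) ^ (m - 2 * ((k + 1 : ℕ) : ℤ) - 1) = (-1) ^ (m - 1) := by
    rw [show m - 2 * ((k + 1 : ℕ) : ℤ) - 1 = m - 1 - 2 * ((k + 1 : ℕ) : ℤ) by ring,
      zpow_sub₀ (by norm_num), zpow_mul]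
    simp
  have h2 : (-1 : ℝ) ^ (m - 2 * (k : ℤ) - 1) = (-1) ^ (m - 1) := by
    rw [show m - 2 * (k : ℤ) - 1 = m - 1 - 2 * (k : ℤ) by ring,
      zpow_sub₀ (by norm_num), zpow_mul]
    simp
  simp only [nabla, Dmap, D1, LinearMap.pi_apply, LinearMap.add_apply, LinearMap.comp_apply,
    LinearMap.proj_apply, Nat.add_eq_zero_iff, one_ne_zero, and_false, if_false,
    LinearMap.smul_apply, Prod.fst_add, LinearMap.prod_apply, Function.prod_apply,
    fst_apply, snd_apply, Prod.smul_fst, inl_apply, Nat.add_sub_cancel, h1]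
  rw [Nat.cast_add, Nat.cast_one, add_sub_cancel_right, h2, smul_add, add_assoc]

theorem nabla_snd (d e : A →ₗ[ℝ] A) (m : ℤ) (ω : ℕ → A × A) (k : ℕ) :
    (nabla d e m ω k).2 = d (ω k).2 := by
  rcases k with _ | k <;> simp [nabla, Dmap]

theorem neg_one_zpow_mul_self (n : ℤ) : (-1 : ℝ) ^ n * (-1) ^ n = 1 := by
  rw [← mul_zpow]; simp

theorem neg_one_zpow_eq (m : ℤ) : (-1 : ℝ) ^ m = -(-1) ^ (m - 1) := by
  rw [zpow_sub₀ (by norm_num), zpow_one, div_neg, div_one, neg_neg]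

theorem neg_one_zpow_sub_two_mul (m k : ℤ) :
    (-1 : ℝ) ^ (m - 2 * k) = (-1) ^ m := by
  rw [zpow_sub₀ (by norm_num), zpow_mul]; simp

theorem nabla_nabla {d e : A →ₗ[ℝ] A} (hd : d ∘ₗ d = 0) (hde : d ∘ₗ e = e ∘ₗ d) (m : ℤ)
    (ω : ℕ → A × A) : nabla d e (m + 1) (nabla d e m ω) = 0 := by
  have hd' : ∀ x, d (d x) = 0 := fun x => LinearMap.congr_fun hd x
  have hde' : ∀ x, d (e x) = e (d x) := fun x => LinearMap.congr_fun hde x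
  funext k
  refine Prod.ext ?_ (by simp [nabla_snd, hd'])
  rcases k with _ | k
  · simp [nabla_zero_fst, nabla_snd, hd', hde', neg_one_zpow_eq m]
  · simp only [nabla_succ_fst, nabla_snd, hd', map_add, map_smul, hde', zero_add,
      add_sub_cancel_right, neg_one_zpow_eq m, neg_smul]
    exact add_neg_cancel _

theorem nabla_mem_Csub {d e : A →ₗ[ℝ] A} (hd : d ∘ₗ d = 0) (hde : d ∘ₗ e = e ∘ₗ d)
    {P Q : ℤ → Submodule ℝ A} (hQP : ∀ n, Q n ≤ P n) {m : ℤ} {ω : ℕ → A × A}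
    (hω : ω ∈ Csub d e P Q m) : nabla d e m ω ∈ Csub d e P Q (m + 1) := by
  have hd' : ∀ x, d (d x) = 0 := fun x => LinearMap.congr_fun hd x
  have hde' : ∀ x, d (e x) = e (d x) := fun x => LinearMap.congr_fun hde x
  rw [mem_Csub] at hω ⊢
  intro k
  have hk := mem_Ksub.1 (hω k)
  have hs : ∀ k : ℤ, (-1 : ℝ) ^ (m - 2 * k - 1) = (-1) ^ (m - 1) := fun k => by
    rw [sub_right_comm, neg_one_zpow_sub_two_mul]
  have e1 : m + 1 - 2 * (k : ℤ) = m - 2 * k + 1 := by ring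
  have e2 : (-1 : ℝ) ^ (m - 2 * (k : ℤ) + 1 - 1) = -(-1) ^ (m - 1) := by
    rw [add_sub_cancel_right, neg_one_zpow_sub_two_mul, neg_one_zpow_eq]
  rw [hs] at hk
  rw [e1, mem_Ksub, e2, nabla_snd, hd']
  refine ⟨?_, by simpa using hk.2.2.1, Submodule.zero_mem _, ?_⟩
  · rcases k with _ | k
    · rw [nabla_zero_fst]
      exact hk.2.2.2
    · rw [nabla_succ_fst, smul_add, ← add_assoc]
      refine Submodule.add_mem _ hk.2.2.2 (Submodule.smul_mem _ _ (hQP _ ?_))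
      have := (mem_Ksub.1 (hω k)).2.1
      convert this using 2
      push_cast; ring
  · rcases k with _ | k
    · simp [nabla_zero_fst, hd', hde']
    · have := (mem_Ksub.1 (hω k)).2.2.1
      simp only [nabla_succ_fst, map_add, map_smul, hd', hde', smul_add, neg_smul, zero_add]
      rw [add_neg_cancel_comm]
      refine Submodule.smul_mem _ _ (hQP _ ?_)
      convert this using 2
      push_cast; ring

theorem mem_FC {d e : A →ₗ[ℝ] A} {P Q : ℤ → Submodule ℝ A} {i m : ℤ} {ω : ℕ → A × A} :
    ω ∈ FC d e P Q i m ↔ ω ∈ Csub d e P Q m ∧ (∀ k : ℕ, m - 2 * (k : ℤ) < i → ω k = 0) ∧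
      ∀ k : ℕ, m + 1 - 2 * (k : ℤ) < i → nabla d e m ω k = 0 := by
  simp [FC, Supp, and_assoc]

theorem mem_Zsp {d e : A →ₗ[ℝ] A} (hd : d ∘ₗ d = 0) (hde : d ∘ₗ e = e ∘ₗ d)
    {P Q : ℤ → Submodule ℝ A} (hQP : ∀ n, Q n ≤ P n) {r i j m : ℤ} (hr : 0 ≤ r)
    (hm : i + j = m) {ω : ℕ → A × A} :
    ω ∈ Zsp d e P Q r i j ↔ ω ∈ Csub d e P Q m ∧
      (∀ k : ℕ, m - 2 * (k : ℤ) < i → ω k = 0) ∧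
      ∀ k : ℕ, m + 1 - 2 * (k : ℤ) < i + r → nabla d e m ω k = 0 := by
  subst hm
  simp only [Zsp, mem_inf, mem_comap, mem_FC, nabla_nabla hd hde]
  constructor
  · rintro ⟨⟨h1, h2, -⟩, -, h3, -⟩
    exact ⟨h1, h2, h3⟩
  · rintro ⟨h1, h2, h3⟩
    exact ⟨⟨h1, h2, fun k hk => h3 k (by lia)⟩, nabla_mem_Csub hd hde hQP h1, h3,
      fun _ _ => rfl⟩

theorem mem_Bsp {d e : A →ₗ[ℝ] A} (hd : d ∘ₗ d = 0) (hde : d ∘ₗ e = e ∘ₗ d)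
    {P Q : ℤ → Submodule ℝ A} (hQP : ∀ n, Q n ≤ P n) {r i j m : ℤ} (hr : 0 ≤ r)
    (hm : i + j - 1 = m) {ω : ℕ → A × A} :
    ω ∈ Bsp d e P Q r i j ↔ ∃ η ∈ Csub d e P Q m,
      (∀ k : ℕ, m - 2 * (k : ℤ) < i - r → η k = 0) ∧
      (∀ k : ℕ, m + 1 - 2 * (k : ℤ) < i → nabla d e m η k = 0) ∧ nabla d e m η = ω := by
  obtain rfl : j = m + 1 - i := by lia
  have e1 : i + (m + 1 - i) = m + 1 := by ring
  simp only [Bsp, mem_inf, mem_map, e1, add_sub_cancel_right, mem_FC]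
  constructor
  · rintro ⟨⟨-, h2, -⟩, η, ⟨h1, h3, -⟩, rfl⟩
    exact ⟨η, h1, h3, h2, rfl⟩
  · rintro ⟨η, h1, h3, h2, rfl⟩
    refine ⟨⟨nabla_mem_Csub hd hde hQP h1, h2, fun k _ => ?_⟩, η, ⟨h1, h3, fun k hk =>
      h2 k (by lia)⟩, rfl⟩
    rw [nabla_nabla hd hde]
    rfl

theorem mem_Zsp_even {d e : A →ₗ[ℝ] A} (hd : d ∘ₗ d = 0) (hde : d ∘ₗ e = e ∘ₗ d)
    {P Q : ℤ → Submodule ℝ A} (hQP : ∀ n, Q n ≤ P n) {r i J : ℤ} {j : ℕ}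
    (hr : r = 2 ∨ r = 3) (hJ : J = 2 * (j : ℤ)) {ω : ℕ → A × A} :
    ω ∈ Zsp d e P Q r i J ↔ ω ∈ Csub d e P Q (i + J) ∧ (∀ k : ℕ, j < k → ω k = 0) ∧
      ∀ k : ℕ, j ≤ k → nabla d e (i + J) ω k = 0 := by
  rw [mem_Zsp hd hde hQP (by lia) rfl]
  refine and_congr Iff.rfl (and_congr (forall_congr' fun k => imp_congr ?_ Iff.rfl)
    (forall_congr' fun k => imp_congr ?_ Iff.rfl)) <;> lia

theorem mem_Zsp_odd {d e : A →ₗ[ℝ] A} (hd : d ∘ₗ d = 0) (hde : d ∘ₗ e = e ∘ₗ d)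
    {P Q : ℤ → Submodule ℝ A} (hQP : ∀ n, Q n ≤ P n) {r i J : ℤ} {j : ℕ}
    (hr : r = 2 ∨ r = 3) (hJ : J = 2 * (j : ℤ)) {ω : ℕ → A × A} :
    ω ∈ Zsp d e P Q (r - 1) (i + 1) (J - 1) ↔ ω ∈ Csub d e P Q (i + J) ∧
      (∀ k : ℕ, j ≤ k → ω k = 0) ∧ ∀ k : ℕ, j ≤ k → nabla d e (i + J) ω k = 0 := by
  rw [mem_Zsp hd hde hQP (m := i + J) (by lia) (by ring)]
  refine and_congr Iff.rfl (and_congr (forall_congr' fun k => imp_congr ?_ Iff.rfl)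
    (forall_congr' fun k => imp_congr ?_ Iff.rfl)) <;> lia

theorem mem_Bsp_even {d e : A →ₗ[ℝ] A} (hd : d ∘ₗ d = 0) (hde : d ∘ₗ e = e ∘ₗ d)
    {P Q : ℤ → Submodule ℝ A} (hQP : ∀ n, Q n ≤ P n) {r i J : ℤ} {j : ℕ}
    (hr : r = 2 ∨ r = 3) (hJ : J = 2 * (j : ℤ)) {ω : ℕ → A × A} :
    ω ∈ Bsp d e P Q (r - 1) i J ↔ ∃ η ∈ Csub d e P Q (i + J - 1),
      (∀ k : ℕ, j < k → η k = 0) ∧ (η j).2 = 0 ∧ nabla d e (i + J - 1) η = ω := by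
  rw [mem_Bsp hd hde hQP (by lia) rfl]
  refine exists_congr fun η => and_congr Iff.rfl ?_
  constructor
  · rintro ⟨h1, h2, h3⟩
    have h4 : ∀ k : ℕ, j < k → η k = 0 := fun k hk => h1 k (by lia)
    refine ⟨h4, ?_, h3⟩
    have h5 := congrArg Prod.fst (h2 (j + 1) (by push_cast; lia))
    rw [nabla_succ_fst, h4 (j + 1) (by lia)] at h5
    simpa [zpow_ne_zero] using h5
  · rintro ⟨h1, h2, h3⟩
    refine ⟨fun k hk => h1 k (by lia), fun k hk => ?_, h3⟩
    obtain ⟨k, rfl⟩ : ∃ l, k = l + 1 := ⟨k - 1, by lia⟩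
    have h5 : (η k).2 = 0 := by
      rcases (show j ≤ k by lia).eq_or_lt with rfl | h
      · exact h2
      · simp [h1 k h]
    have h6 := h1 (k + 1) (by lia)
    refine Prod.ext ?_ ?_
    · simp [nabla_succ_fst, h5, h6]
    · simp [nabla_snd, h6]

theorem snd_eq_zero_of_mem_Zsp {d e : A →ₗ[ℝ] A} (hd : d ∘ₗ d = 0) (hde : d ∘ₗ e = e ∘ₗ d)
    {P Q : ℤ → Submodule ℝ A} (hQP : ∀ n, Q n ≤ P n) {r i J : ℤ} {j : ℕ}
    (hr : r = 2 ∨ r = 3) (hJ : J = 2 * (j : ℤ)) {ω : ℕ → A × A}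
    (hω : ω ∈ Zsp d e P Q r i J) : (ω j).2 = 0 := by
  obtain ⟨-, h1, h2⟩ := (mem_Zsp_even hd hde hQP hr hJ).1 hω
  have h := congrArg Prod.fst (h2 (j + 1) (by lia))
  rw [nabla_succ_fst, h1 (j + 1) (by lia)] at h
  simpa [zpow_ne_zero] using h

theorem fst_mem_Om_of_mem_Zsp {d e : A →ₗ[ℝ] A} (hd : d ∘ₗ d = 0) (hde : d ∘ₗ e = e ∘ₗ d)
    {P Q : ℤ → Submodule ℝ A} (hQP : ∀ n, Q n ≤ P n) {r i J : ℤ} {j : ℕ}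
    (hr : r = 2 ∨ r = 3) (hJ : J = 2 * (j : ℤ)) {ω : ℕ → A × A}
    (hω : ω ∈ Zsp d e P Q r i J) : (ω j).1 ∈ Om d P i := by
  have h := mem_Csub.1 ((mem_Zsp_even hd hde hQP hr hJ).1 hω).1 j
  rw [show i + J - 2 * (j : ℤ) = i by lia] at h
  exact fst_mem_Om h (snd_eq_zero_of_mem_Zsp hd hde hQP hr hJ hω)

/-- A linear map carrying cocycles onto cocycles and reflecting coboundaries induces an
isomorphism of the quotients. -/
theorem exists_Hq_equiv {M N : Type*} [AddCommGroup M] [Module ℝ M] [AddCommGroup N]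
    [Module ℝ N] (Z B : Submodule ℝ M) (Z' B' : Submodule ℝ N) (f : M →ₗ[ℝ] N)
    (hf : ∀ x ∈ Z, f x ∈ Z') (hB : ∀ x ∈ Z, f x ∈ B' ↔ x ∈ B)
    (hsurj : ∀ y ∈ Z', ∃ x ∈ Z, f x = y) :
    ∃ φ : Hq Z B ≃ₗ[ℝ] Hq Z' B', ∀ (x : M) (hx : x ∈ Z) (h : f x ∈ Z'),
      φ (Submodule.Quotient.mk ⟨x, hx⟩) = Submodule.Quotient.mk ⟨f x, h⟩ := by
  have hle : B.comap Z.subtype ≤ (B'.comap Z'.subtype).comap (f.restrict hf) :=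
    fun x hx => (hB x x.2).2 hx
  refine ⟨LinearEquiv.ofBijective (Submodule.mapQ _ _ (f.restrict hf) hle) ⟨?_, ?_⟩,
    fun x hx h => rfl⟩
  · rw [injective_iff_map_eq_zero]
    intro q
    obtain ⟨x, rfl⟩ := Submodule.Quotient.mk_surjective _ q
    intro h
    rw [Submodule.mapQ_apply, Submodule.Quotient.mk_eq_zero] at h
    exact (Submodule.Quotient.mk_eq_zero _).2 ((hB x x.2).1 h)
  · intro q
    obtain ⟨y, rfl⟩ := Submodule.Quotient.mk_surjective _ q
    obtain ⟨x, hx, hxy⟩ := hsurj y y.2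
    exact ⟨Submodule.Quotient.mk ⟨x, hx⟩, congrArg Submodule.Quotient.mk (Subtype.ext hxy)⟩

theorem exists_Esp_equiv_HOm {d e : A →ₗ[ℝ] A} (hd : d ∘ₗ d = 0) (hde : d ∘ₗ e = e ∘ₗ d)
    {P Q : ℤ → Submodule ℝ A} (hQP : ∀ n, Q n ≤ P n) (i : ℤ) {r : ℤ} (hr : r = 2 ∨ r = 3) :
    ∃ φ : Esp d e P Q r i 0 ≃ₗ[ℝ] HOm d P i,
      ∀ (ω : ℕ → A × A) (hω : ω ∈ Zsp d e P Q r i 0) (h1 : (ω 0).1 ∈ ZOm d P i),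
        φ (Submodule.Quotient.mk ⟨ω, hω⟩) = Submodule.Quotient.mk ⟨(ω 0).1, h1⟩ := by
  have hJ : (0 : ℤ) = 2 * ((0 : ℕ) : ℤ) := by simp
  refine exists_Hq_equiv _ _ _ _
    (LinearMap.fst ℝ A A ∘ₗ LinearMap.proj (R := ℝ) (φ := fun _ : ℕ => A × A) 0) ?_ ?_ ?_
  · intro ω hω
    refine mem_inf.2 ⟨fst_mem_Om_of_mem_Zsp hd hde hQP hr hJ hω, ?_⟩
    have h := congrArg Prod.fst (((mem_Zsp_even hd hde hQP hr hJ).1 hω).2.2 0 le_rfl)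
    rw [nabla_zero_fst, snd_eq_zero_of_mem_Zsp hd hde hQP hr hJ hω] at h
    simpa using h
  · intro ω hω
    have hω' := (mem_Zsp_even hd hde hQP hr hJ).1 hω
    have hs := snd_eq_zero_of_mem_Zsp hd hde hQP hr hJ hω
    constructor
    · rintro ⟨α, hα, hαω⟩
      refine mem_sup_right ((mem_Bsp_even hd hde hQP hr hJ).2 ⟨Pi.single 0 (α, 0),
        single_mem_Csub (mk_zero_mem_Ksub.2 ?_), fun k hk => Pi.single_eq_of_ne hk.ne' _,
        by simp, ?_⟩)
      · convert hα using 1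
        simp
      · funext k
        rcases k with _ | k
        · refine Prod.ext ?_ ?_
          · simpa [nabla_zero_fst] using hαω
          · simp [nabla_snd, hs]
        · rw [hω'.2.1 (k + 1) (by lia)]
          refine Prod.ext ?_ (by simp [nabla_snd])
          rcases k with _ | k <;> simp [nabla_succ_fst]
    · intro h
      obtain ⟨z, hz, b, hb, rfl⟩ := mem_sup.1 h
      have hz0 := ((mem_Zsp_odd hd hde hQP hr hJ).1 hz).2.1 0 le_rfl
      obtain ⟨η, hη, -, hη2, rfl⟩ := (mem_Bsp_even hd hde hQP hr hJ).1 hb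
      refine ⟨(η 0).1, ?_, ?_⟩
      · have h0 := mem_Csub.1 hη 0
        rw [show i + 0 - 1 - 2 * ((0 : ℕ) : ℤ) = i - 1 by simp] at h0
        exact fst_mem_Om h0 hη2
      · simp [nabla_zero_fst, hη2, hz0]
  · intro α hα
    have hα' := mem_inf.1 hα
    refine ⟨Pi.single 0 (α, 0), (mem_Zsp_even hd hde hQP hr hJ).2
      ⟨single_mem_Csub (mk_zero_mem_Ksub.2 (by simpa using hα'.1)),
        fun k hk => Pi.single_eq_of_ne hk.ne' _, fun k _ => ?_⟩, by simp⟩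
    refine Prod.ext ?_ ?_
    · rcases k with _ | _ | k
      · simpa [nabla_zero_fst] using hα'.2
      · simp [nabla_succ_fst]
      · simp [nabla_succ_fst]
    · rcases k with _ | k <;> simp [nabla_snd]

theorem exists_Esp_equiv_HKo {d e : A →ₗ[ℝ] A} (hd : d ∘ₗ d = 0) (hde : d ∘ₗ e = e ∘ₗ d)
    {P Q : ℤ → Submodule ℝ A} (hQP : ∀ n, Q n ≤ P n) (i : ℤ) {r : ℤ} (hr : r = 2 ∨ r = 3)
    {j : ℕ} (hj : 0 < j) :
    ∃ ψ : Esp d e P Q r i (2 * (j : ℤ)) ≃ₗ[ℝ] HKo d e P Q i,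
      ∀ (ω : ℕ → A × A) (hω : ω ∈ Zsp d e P Q r i (2 * (j : ℤ)))
        (h1 : (ω j).1 ∈ ZKo d e P Q i),
        ψ (Submodule.Quotient.mk ⟨ω, hω⟩) = Submodule.Quotient.mk ⟨(ω j).1, h1⟩ := by
  obtain ⟨j, rfl⟩ : ∃ l, j = l + 1 := ⟨j - 1, by lia⟩
  generalize hJ : 2 * ((j + 1 : ℕ) : ℤ) = J
  replace hJ := hJ.symm
  have hdeg : i + J - 2 * (j : ℤ) = i + 1 + 1 := by push_cast at hJ; lia
  have hdeg' : i + J - 1 - 2 * (j : ℤ) = i + 1 := by push_cast at hJ; lia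
  have hdeg'' : i + J - 1 - 2 * ((j + 1 : ℕ) : ℤ) = i - 1 := by lia
  refine exists_Hq_equiv _ _ _ _
    (LinearMap.fst ℝ A A ∘ₗ LinearMap.proj (R := ℝ) (φ := fun _ : ℕ => A × A) (j + 1)) ?_ ?_ ?_
  · intro ω hω
    refine mem_inf.2 ⟨fst_mem_Om_of_mem_Zsp hd hde hQP hr hJ hω, ?_⟩
    have hω' := (mem_Zsp_even hd hde hQP hr hJ).1 hω
    have h := congrArg Prod.fst (hω'.2.2 (j + 1) le_rfl)
    rw [nabla_succ_fst, snd_eq_zero_of_mem_Zsp hd hde hQP hr hJ hω, map_zero, zero_add,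
      Prod.fst_zero, add_eq_zero_iff_eq_neg] at h
    change d (ω (j + 1)).1 ∈ Gsub d e P Q (i + 1)
    rw [h]
    refine neg_mem (Submodule.smul_mem _ _ (mem_Gsub.2 ⟨(ω j).1, ?_⟩))
    rw [← hdeg]
    exact mem_Csub.1 hω'.1 j
  · intro ω hω
    have hω' := (mem_Zsp_even hd hde hQP hr hJ).1 hω
    have hs := snd_eq_zero_of_mem_Zsp hd hde hQP hr hJ hω
    constructor
    · intro h
      obtain ⟨g, hg, b, ⟨α, hα, rfl⟩, hgα⟩ := mem_sup.1 h
      have hgα : g + d α = (ω (j + 1)).1 := hgα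
      obtain ⟨a, ha⟩ := mem_Gsub.1
        (Submodule.smul_mem _ ((-1 : ℝ) ^ (i + J - 1 - 1)) hg)
      set x : A × A := (a, (-1 : ℝ) ^ (i + J - 1 - 1) • g) with hx
      set η : ℕ → A × A := Pi.single j x + Pi.single (j + 1) (α, 0) with hη
      have hηj : η j = x := by simp [hη]
      have hηs : η (j + 1) = (α, 0) := by simp [hη]
      have hη0 : ∀ k, j + 1 < k → η k = 0 := fun k hk => by
        simp [hη, Pi.single_eq_of_ne (show k ≠ j by lia),
          Pi.single_eq_of_ne (show k ≠ j + 1 by lia)]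
      have hηC : η ∈ Csub d e P Q (i + J - 1) := by
        refine add_mem (single_mem_Csub ?_) (single_mem_Csub (mk_zero_mem_Ksub.2 ?_))
        · rwa [hdeg']
        · rwa [hdeg'']
      have hb : nabla d e (i + J - 1) η ∈ Bsp d e P Q (r - 1) i J :=
        (mem_Bsp_even hd hde hQP hr hJ).2 ⟨η, hηC, hη0, by rw [hηs], rfl⟩
      rw [← sub_add_cancel ω (nabla d e (i + J - 1) η)]
      refine add_mem (mem_sup_left ((mem_Zsp_odd hd hde hQP hr hJ).2 ⟨?_, ?_, ?_⟩))
        (mem_sup_right hb)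
      · have := nabla_mem_Csub hd hde hQP hηC
        rw [sub_add_cancel] at this
        exact sub_mem hω'.1 this
      · intro k hk
        rw [Pi.sub_apply, sub_eq_zero]
        obtain ⟨k, rfl⟩ : ∃ l, k = l + 1 := ⟨k - 1, by lia⟩
        rcases hk.eq_or_lt with h | h
        · obtain rfl : j = k := by lia
          refine Prod.ext ?_ ?_
          · rw [nabla_succ_fst, hηs, hηj, hx, ← hgα]
            simp only [map_zero, zero_add, smul_smul, neg_one_zpow_mul_self, one_smul]
            exact add_comm _ _
          · rw [nabla_snd, hηs, hs, map_zero]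
        · rw [hω'.2.1 _ h]
          have hk2 : (η k).2 = 0 := by
            rcases (show j + 1 ≤ k by lia).eq_or_lt with rfl | h'
            · rw [hηs]
            · rw [hη0 k h']; rfl
          refine Prod.ext ?_ ?_
          · simp [nabla_succ_fst, hη0 _ h, hk2]
          · simp [nabla_snd, hη0 _ h]
      · intro k hk
        have := nabla_nabla hd hde (i + J - 1) η
        rw [sub_add_cancel] at this
        rw [map_sub, this, sub_zero]
        exact hω'.2.2 k hk
    · intro h
      obtain ⟨z, hz, b, hb, rfl⟩ := mem_sup.1 h
      have hz0 := ((mem_Zsp_odd hd hde hQP hr hJ).1 hz).2.1 (j + 1) le_rfl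
      obtain ⟨η, hη, -, hη2, rfl⟩ := (mem_Bsp_even hd hde hQP hr hJ).1 hb
      refine mem_sup.2 ⟨(-1 : ℝ) ^ (i + J - 1 - 1) • (η j).2, Submodule.smul_mem _ _
        (mem_Gsub.2 ⟨(η j).1, ?_⟩), _, ⟨(η (j + 1)).1, ?_, rfl⟩, ?_⟩
      · rw [← hdeg']
        exact mem_Csub.1 hη j
      · have h0 := mem_Csub.1 hη (j + 1)
        rw [hdeg''] at h0
        exact fst_mem_Om h0 hη2
      · simp [nabla_succ_fst, hη2, hz0, add_comm]
  · intro α hα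
    obtain ⟨hαΩ, hαG⟩ := mem_inf.1 hα
    obtain ⟨a, ha⟩ := mem_Gsub.1
      (Submodule.smul_mem _ (-(-1 : ℝ) ^ (i + J - 1)) (mem_comap.1 hαG))
    set x : A × A := (a, -(-1 : ℝ) ^ (i + J - 1) • d α) with hx
    set η : ℕ → A × A := Pi.single j x + Pi.single (j + 1) (α, 0) with hη
    have hηj : η j = x := by simp [hη]
    have hηs : η (j + 1) = (α, 0) := by simp [hη]
    have hη0 : ∀ k, j + 1 < k → η k = 0 := fun k hk => by
      simp [hη, Pi.single_eq_of_ne (show k ≠ j by lia),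
        Pi.single_eq_of_ne (show k ≠ j + 1 by lia)]
    refine ⟨η, (mem_Zsp_even hd hde hQP hr hJ).2 ⟨?_, hη0, ?_⟩, congrArg Prod.fst hηs⟩
    · refine add_mem (single_mem_Csub ?_) (single_mem_Csub (mk_zero_mem_Ksub.2 ?_))
      · rwa [hdeg]
      · rwa [show i + J - 2 * ((j + 1 : ℕ) : ℤ) = i by lia]
    · intro k hk
      obtain ⟨k, rfl⟩ : ∃ l, k = l + 1 := ⟨k - 1, by lia⟩
      rcases hk.eq_or_lt with h | h
      · obtain rfl : j = k := by lia
        refine Prod.ext ?_ ?_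
        · rw [nabla_succ_fst, hηs, hηj, hx]
          simp only [map_zero, zero_add, smul_smul, neg_smul, smul_neg,
            neg_one_zpow_mul_self, one_smul, Prod.fst_zero, add_neg_cancel]
        · rw [nabla_snd, hηs, map_zero]; rfl
      · have hk2 : (η k).2 = 0 := by
          rcases (show j + 1 ≤ k by lia).eq_or_lt with rfl | h'
          · rw [hηs]
          · rw [hη0 k h']; rfl
        refine Prod.ext ?_ ?_
        · simp [nabla_succ_fst, hη0 _ h, hk2]
        · simp [nabla_snd, hη0 _ h]

/-- the second and third pages of the basic spectral sequence:
`E_2^{i,0} = E_3^{i,0} ≅ H^i(Ω)` and, for `j > 0`,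
`E_2^{i,2j} = E_3^{i,2j} ≅ H^i(𝒦) ⊗ ℝ·u^j`, where `𝒦 = Ω/G` is the co-Gysin complex.
The isomorphisms send the class of a cocycle `ω` to the class of the coefficient of
`u^0` (resp. `u^j`). -/
theorem statement_8 {A : Type*} [AddCommGroup A] [Module ℝ A]
    (d e : A →ₗ[ℝ] A) (hd : d ∘ₗ d = 0) (hde : d ∘ₗ e = e ∘ₗ d)
    (P Q : ℤ → Submodule ℝ A) (hQP : ∀ n, Q n ≤ P n)
    (hPneg : ∀ n : ℤ, n < 0 → P n = ⊥) (hQneg : ∀ n : ℤ, n < 0 → Q n = ⊥)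
    (i : ℤ) :
    -- E_2^{i,0} ≅ H^i(Ω)
    (∃ φ : Esp d e P Q 2 i 0 ≃ₗ[ℝ] HOm d P i,
      ∀ (ω : ℕ → A × A) (hω : ω ∈ Zsp d e P Q 2 i 0) (h1 : (ω 0).1 ∈ ZOm d P i),
        φ (Submodule.Quotient.mk ⟨ω, hω⟩) = Submodule.Quotient.mk ⟨(ω 0).1, h1⟩) ∧
    -- E_3^{i,0} ≅ H^i(Ω)
    (∃ φ : Esp d e P Q 3 i 0 ≃ₗ[ℝ] HOm d P i,
      ∀ (ω : ℕ → A × A) (hω : ω ∈ Zsp d e P Q 3 i 0) (h1 : (ω 0).1 ∈ ZOm d P i),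
        φ (Submodule.Quotient.mk ⟨ω, hω⟩) = Submodule.Quotient.mk ⟨(ω 0).1, h1⟩) ∧
    -- E_2^{i,2j} = E_3^{i,2j} ≅ H^i(𝒦)⊗ℝ·u^j for j > 0
    (∀ j : ℕ, 0 < j →
      (∃ ψ : Esp d e P Q 2 i (2 * (j : ℤ)) ≃ₗ[ℝ] HKo d e P Q i,
        ∀ (ω : ℕ → A × A) (hω : ω ∈ Zsp d e P Q 2 i (2 * (j : ℤ)))
          (h1 : (ω j).1 ∈ ZKo d e P Q i),
          ψ (Submodule.Quotient.mk ⟨ω, hω⟩) = Submodule.Quotient.mk ⟨(ω j).1, h1⟩) ∧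
      (∃ ψ : Esp d e P Q 3 i (2 * (j : ℤ)) ≃ₗ[ℝ] HKo d e P Q i,
        ∀ (ω : ℕ → A × A) (hω : ω ∈ Zsp d e P Q 3 i (2 * (j : ℤ)))
          (h1 : (ω j).1 ∈ ZKo d e P Q i),
          ψ (Submodule.Quotient.mk ⟨ω, hω⟩) = Submodule.Quotient.mk ⟨(ω j).1, h1⟩)) := by
  exact ⟨exists_Esp_equiv_HOm hd hde hQP i (Or.inl rfl),
    exists_Esp_equiv_HOm hd hde hQP i (Or.inr rfl), fun j hj =>
    ⟨exists_Esp_equiv_HKo hd hde hQP i (Or.inl rfl) hj,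
      exists_Esp_equiv_HKo hd hde hQP i (Or.inr rfl) hj⟩⟩

end IG

end
end

section
/- For every r ≥ 3 and every i, the term E_r^{i,0} of the basic spectral sequence is naturally a quotient of H^i(Ω): the cocycle space Z_r^{i,0} consists exactly of the elements (α,0)⊗1 with α ∈ Ω^i and dα = 0, the subgroup being divided out contains {(dα',0)⊗1 : α' ∈ Ω^{i−1}}, and hence the assignment [α] ↦ class of (α,0)⊗1 defines a surjective linear map q_r : H^i(Ω) ↠ E_r^{i,0}. -/
/-!
Common algebraic model for the paper "Intersection cohomology of circle actions"
(Padilla–Saralegi), following the CONTEXT of the statements.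

`A` models the (total space of the) graded-commutative differential graded ℝ-algebra
`A = ⊕ₙ Aⁿ` of liftable forms on the orbit space `B`; the grading is only recorded
through the families of graded subspaces `P Q : ℤ → Submodule ℝ A` (the forms of
perverse degree `≤ p̄` resp. `≤ p̄ - x̄`), which vanish in negative degrees
(`Aⁿ = 0` for `n < 0`).  The differential is `d` with `d ∘ d = 0`, and
`e : A →ₗ[ℝ] A` is right multiplication by the fixed Euler form `ε ∈ A²`;
the hypotheses `dε = 0` together with the graded Leibniz rule amount exactly to
the commutation `d ∘ e = e ∘ d`, which is how we encode them.
-/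

open Submodule LinearMap

noncomputable section

namespace IG

variable {A : Type*} [AddCommGroup A] [Module ℝ A]

section Embedding

variable (d e : A →ₗ[ℝ] A) (P Q : ℤ → Submodule ℝ A)

theorem embL_zero (α : A) : embL α 0 = (α, 0) := by
  simp [embL]

theorem embL_of_ne_zero (α : A) {j : ℕ} (hj : j ≠ 0) : embL α j = 0 := by
  simp [embL, hj]

theorem nabla_embL (m : ℤ) (α : A) : nabla d e m (embL α) = embL (d α) := by
  funext j
  rcases j with _ | _ | j <;> simp [nabla, embL, Dmap, D1]

theorem mem_Supp {i m : ℤ} {ω : ℕ → A × A} :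
    ω ∈ Supp i m ↔ ∀ j : ℕ, m - 2 * (j : ℤ) < i → ω j = 0 := by
  simp [Supp]

theorem embL_mem_Supp {i m : ℤ} (h : i ≤ m) (α : A) : embL α ∈ Supp i m :=
  mem_Supp.2 fun j hj => embL_of_ne_zero α (by rintro rfl; simp at hj; omega)

variable {d P}

theorem embL_mem_Csub {m : ℤ} {α : A} (h : α ∈ Om d P m) : embL α ∈ Csub d e P Q m := by
  obtain ⟨h₁, h₂⟩ := h
  simp only [Csub, mem_iInf, mem_comap, proj_apply]
  intro j
  rcases eq_or_ne j 0 with rfl | hj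
  · rw [embL_zero]
    simpa [Ksub, D1] using And.intro h₁ h₂
  · rw [embL_of_ne_zero α hj]
    exact zero_mem _

theorem embL_mem_FC {i m : ℤ} (him : i ≤ m) {α : A} (h : α ∈ Om d P m) :
    embL α ∈ FC d e P Q i m := by
  refine ⟨⟨embL_mem_Csub e Q h, embL_mem_Supp him α⟩, ?_⟩
  rw [SetLike.mem_coe, mem_comap, nabla_embL]
  exact embL_mem_Supp (by omega) _

theorem eq_embL_of_mem_FC {i : ℤ} {ω : ℕ → A × A} (h : ω ∈ FC d e P Q i i) :
    ∃ α ∈ Om d P i, ω = embL α := by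
  obtain ⟨⟨hC, hS⟩, hN⟩ := h
  rw [SetLike.mem_coe, mem_comap] at hN
  have hω : ∀ j : ℕ, j ≠ 0 → ω j = 0 := fun j hj => mem_Supp.1 hS j (by omega)
  have hβ : (ω 0).2 = 0 := by
    have h := mem_Supp.1 hN 1 (by push_cast; omega)
    have h₁ := congrArg Prod.fst h
    simpa [nabla, hω 1 one_ne_zero, zpow_ne_zero] using h₁
  have hω' : ω = embL (ω 0).1 := by
    funext j
    rcases eq_or_ne j 0 with rfl | hj
    · rw [embL_zero]
      exact Prod.ext rfl hβ
    · rw [hω j hj, embL_of_ne_zero _ hj]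
  refine ⟨(ω 0).1, ?_, hω'⟩
  have hK : ω 0 ∈ Ksub d e P Q (i - 2 * ((0 : ℕ) : ℤ)) := by
    simp only [Csub, SetLike.mem_coe, mem_iInf, mem_comap, proj_apply] at hC
    exact hC 0
  obtain ⟨⟨⟨h₁, -⟩, -⟩, h₂⟩ := hK
  constructor
  · simpa using h₁
  · simpa [D1, hβ] using h₂

/-- Already for `r ≥ 2`, the cocycles on the bottom row are the `(α, 0) ⊗ 1` with `α` a
cocycle of `Ω`. -/
theorem Zsp_zero_eq_map {r : ℤ} (hr : 2 ≤ r) (i : ℤ) :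
    Zsp d e P Q r i 0 = (ZOm d P i).map embL := by
  ext ω
  simp only [Zsp, add_zero]
  constructor
  · rintro ⟨hF, hN⟩
    obtain ⟨α, hα, rfl⟩ := eq_embL_of_mem_FC e Q hF
    refine ⟨α, ⟨hα, ?_⟩, rfl⟩
    rw [SetLike.mem_coe, mem_comap, nabla_embL] at hN
    have h := mem_Supp.1 hN.1.2 0 (by push_cast; omega)
    rw [embL_zero] at h
    exact congrArg Prod.fst h
  · rintro ⟨α, ⟨hα, hdα⟩, rfl⟩
    refine ⟨embL_mem_FC e Q le_rfl hα, ?_⟩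
    rw [SetLike.mem_coe, mem_comap, nabla_embL, mem_ker.1 hdα, map_zero]
    exact zero_mem _

theorem map_BOm_le_Bsp (hd : d ∘ₗ d = 0) {r : ℤ} (hr : 1 ≤ r) (i : ℤ) :
    (BOm d P i).map embL ≤ Bsp d e P Q r i 0 := by
  rintro _ ⟨_, ⟨α, hα, rfl⟩, rfl⟩
  have hP : d α ∈ P i := by
    simpa using hα.2
  have hdd : d (d α) = 0 := LinearMap.congr_fun hd α
  simp only [Bsp, add_zero]
  refine ⟨embL_mem_FC e Q le_rfl ⟨hP, ?_⟩, embL α, embL_mem_FC e Q (by omega) hα,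
    nabla_embL d e _ α⟩
  rw [SetLike.mem_coe, mem_comap, hdd]
  exact zero_mem _

end Embedding

/-- for every `r ≥ 3` and every `i`, the term `E_r^{i,0}` is naturally a
quotient of `H^i(Ω)`: the cocycle space `Z_r^{i,0}` consists exactly of the elements
`(α,0)⊗1` with `α ∈ Ω^i` and `dα = 0`; the divided-out subgroup contains
`{(dα',0)⊗1 : α' ∈ Ω^(i-1)}`; and `[α] ↦ class of (α,0)⊗1` defines a surjective
linear map `q_r : H^i(Ω) ↠ E_r^{i,0}`. -/
theorem statement_11 {A : Type*} [AddCommGroup A] [Module ℝ A]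
    (d e : A →ₗ[ℝ] A) (hd : d ∘ₗ d = 0) (hde : d ∘ₗ e = e ∘ₗ d)
    (P Q : ℤ → Submodule ℝ A) (hQP : ∀ n, Q n ≤ P n)
    (hPneg : ∀ n : ℤ, n < 0 → P n = ⊥) (hQneg : ∀ n : ℤ, n < 0 → Q n = ⊥)
    (r i : ℤ) (hr : 3 ≤ r) :
    -- Z_r^{i,0} = {(α,0)⊗1 : α ∈ Ω^i, dα = 0}
    Zsp d e P Q r i 0 = (ZOm d P i).map embL ∧
    -- the divided-out subgroup contains the coboundaries {(dα',0)⊗1 : α' ∈ Ω^(i-1)}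
    (BOm d P i).map embL ≤
      Zsp d e P Q (r - 1) (i + 1) (0 - 1) ⊔ Bsp d e P Q (r - 1) i 0 ∧
    -- the induced surjection q_r : H^i(Ω) ↠ E_r^{i,0}
    ∃ q : HOm d P i →ₗ[ℝ] Esp d e P Q r i 0,
      Function.Surjective q ∧
      ∀ (α : A) (hα : α ∈ ZOm d P i) (h2 : embL α ∈ Zsp d e P Q r i 0),
        q (Submodule.Quotient.mk ⟨α, hα⟩) = Submodule.Quotient.mk ⟨embL α, h2⟩ := by
  have hZ := Zsp_zero_eq_map (d := d) (P := P) e Q (show 2 ≤ r by omega) i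
  have hB : (BOm d P i).map embL ≤
      Zsp d e P Q (r - 1) (i + 1) (0 - 1) ⊔ Bsp d e P Q (r - 1) i 0 :=
    (map_BOm_le_Bsp e Q hd (by omega) i).trans le_sup_right
  have hmem : ∀ α ∈ ZOm d P i, embL α ∈ Zsp d e P Q r i 0 := fun α hα =>
    hZ ▸ Submodule.mem_map_of_mem hα
  refine ⟨hZ, hB, Submodule.mapQ _ _ (embL.restrict hmem) ?_, ?_, fun _ _ _ => rfl⟩
  · exact fun α hα => hB (Submodule.mem_map_of_mem hα)
  · intro x
    obtain ⟨⟨ω, hω⟩, rfl⟩ := Submodule.Quotient.mk_surjective _ x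
    obtain ⟨α, hα, rfl⟩ : ω ∈ (ZOm d P i).map embL := hZ ▸ hω
    exact ⟨Submodule.Quotient.mk ⟨α, hα⟩, rfl⟩

end IG

end
end
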